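/- For d = 1 and every real p ≥ 1, the quantity 2p − 2·(2 + √((3p−2)² + (3p−4))) / (−3p+6 + √((3p−2)² + (3p−4))) equals (4p − 2 − 2√(p(p−1)))/3, and moreover (4p − 2 − 2√(p(p−1)))/3 > (p−1)/2 for all p ≥ 1. -/

import Mathlib

/-- **Remark 1.2 (v), case `d = 1`**: for every real `p ≥ 1`,
`2p − 2(2 + √((3p−2)² + (3p−4)))/(−3p+6 + √((3p−2)² + (3p−4))) = (4p − 2 − 2√(p(p−1)))/3`,
and `(4p − 2 − 2√(p(p−1)))/3 > (p−1)/2`. -/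
theorem lower_bound_dim_one (p : ℝ) (hp : 1 ≤ p) :
    (2*p - 2 * (2 + Real.sqrt ((3*p - 2)^2 + (3*p - 4))) /
        (-(3*p) + 6 + Real.sqrt ((3*p - 2)^2 + (3*p - 4)))
      = (4*p - 2 - 2 * Real.sqrt (p*(p - 1))) / 3) ∧
    (p - 1)/2 < (4*p - 2 - 2 * Real.sqrt (p*(p - 1))) / 3 := by
  have hsqrt : Real.sqrt ((3*p - 2)^2 + (3*p - 4)) = 3 * Real.sqrt (p*(p - 1)) := by
    rw [show (3*p - 2)^2 + (3*p - 4) = 3^2 * (p*(p - 1)) by ring,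
      Real.sqrt_mul (by norm_num), Real.sqrt_sq (by norm_num)]
  rw [hsqrt]
  have hs : 0 ≤ Real.sqrt (p*(p - 1)) := Real.sqrt_nonneg _
  have hsq : Real.sqrt (p*(p - 1)) ^ 2 = p*(p - 1) :=
    Real.sq_sqrt (mul_nonneg (by linarith) (by linarith))
  generalize Real.sqrt (p*(p - 1)) = s at hs hsq ⊢
  have hden : 0 < -(3*p) + 6 + 3*s := by
    by_contra! h
    nlinarith
  constructor
  · rw [sub_eq_iff_eq_add, ← sub_eq_iff_eq_add', eq_div_iff hden.ne']
    linear_combination 2 * hsq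
  · have : 4*s < 5*p - 1 := by
      by_contra! h
      nlinarith
    linarith
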